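/- There is an algorithm that, given an integer k ≥ 2, a DFAO M generating a k-automatic sequence a = (a_n)_{n≥0}, and a rational number r > 1, decides whether a contains infinitely many occurrences of r-powers (i.e., whether there are infinitely many positions I ≥ 0 at which an r-power factor begins); similarly for r^+-powers. -/

import Mathlib

/-- Run an encoded DFAO transition table from state `q` on a list of base-`k`
digits, least significant digit first (this is `w^R` for a most-significant-first
representation `w`). -/
def dfaoRun (trans : List (List ℕ)) : ℕ → List ℕ → ℕ
  | q, [] => q
  | q, d :: ds => dfaoRun trans ((trans.getD q []).getD d 0) ds

/-- The encoded DFAO `(trans, q0, out)` over input alphabet `Σ_k = {0,…,k-1}`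
generates the sequence `a`: for every `m` and every base-`k` representation `w`
of `m` (given least significant digit first, possibly with trailing zeros,
all digits `< k`), the output on `w` is `a m`. -/
def dfaoGenerates (k : ℕ) (trans : List (List ℕ)) (q0 : ℕ) (out : List ℕ)
    (a : ℕ → ℕ) : Prop :=
  ∀ (m : ℕ) (w : List ℕ), (∀ d ∈ w, d < k) → Nat.ofDigits k w = m →
    a m = out.getD (dfaoRun trans q0 w) 0

/-- The factor `a_i a_{i+1} ⋯ a_{i+L-1}` of the sequence `a`. -/
def factorAt (a : ℕ → ℕ) (i L : ℕ) : List ℕ :=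
  (List.range L).map fun j => a (i + j)

/-- `w` is a factor of the infinite word `a`. -/
def IsFactorOf (a : ℕ → ℕ) (w : List ℕ) : Prop :=
  ∃ i : ℕ, w = factorAt a i w.length

/-- `z` is an `r`-power `x^r` for `r = p/q` built from a word `x` of length `T`:
`z` is the shortest prefix of `x^ω` of length `≥ (p/q)·T`, i.e. `z` has length
`⌈(p/q)·T⌉`, has period `T`, and `x` is its prefix of length `T`. -/
def IsRPowerOf (p q T : ℕ) (z : List ℕ) : Prop :=
  1 ≤ T ∧ T ≤ z.length ∧
    (∀ j : ℕ, j + T < z.length → z.getD j 0 = z.getD (j + T) 0) ∧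
    p * T ≤ q * z.length ∧ q * (z.length - 1) < p * T

/-- `z` is an `r⁺`-power for `r = p/q` built from a word `x` of length `T`:
`z` is the shortest prefix of `x^ω` of length `> (p/q)·T`. -/
def IsRPlusPowerOf (p q T : ℕ) (z : List ℕ) : Prop :=
  1 ≤ T ∧ T ≤ z.length ∧
    (∀ j : ℕ, j + T < z.length → z.getD j 0 = z.getD (j + T) 0) ∧
    p * T < q * z.length ∧ q * (z.length - 1) ≤ p * T

/-- `z` is an `r`-power for `r = p/q`. -/
def IsRPower (p q : ℕ) (z : List ℕ) : Prop :=
  ∃ T : ℕ, IsRPowerOf p q T z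

/-- `z` is an `r⁺`-power for `r = p/q`. -/
def IsRPlusPower (p q : ℕ) (z : List ℕ) : Prop :=
  ∃ T : ℕ, IsRPlusPowerOf p q T z

/-- The list of the `e` least significant base-`k` digits of `x`. -/
def lowDigits (k e x : ℕ) : List ℕ :=
  (List.range e).map fun i => x / k ^ i % k

theorem ofDigits_lowDigits (k e x : ℕ) : Nat.ofDigits k (lowDigits k e x) = x % k ^ e := by
  induction e with
  | zero => simp [lowDigits, Nat.mod_one]
  | succ e ih =>
    have h : lowDigits k (e + 1) x = lowDigits k e x ++ [x / k ^ e % k] := by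
      simp [lowDigits, List.range_succ]
    rw [h, Nat.ofDigits_append, ih, Nat.mod_pow_succ]
    simp [lowDigits]

theorem lt_of_mem_lowDigits {k e x d : ℕ} (hk : 0 < k) (hd : d ∈ lowDigits k e x) : d < k := by
  obtain ⟨i, -, rfl⟩ := List.mem_map.1 hd
  exact Nat.mod_lt _ hk

theorem length_lowDigits (k e x : ℕ) : (lowDigits k e x).length = e := by
  simp [lowDigits]

theorem dfaoRun_eq_foldl (trans : List (List ℕ)) (s : ℕ) (w : List ℕ) :
    dfaoRun trans s w = w.foldl (fun s d => (trans.getD s []).getD d 0) s := by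
  induction w generalizing s with
  | nil => rfl
  | cons d w ih => exact ih _

theorem dfaoRun_append (trans : List (List ℕ)) (s : ℕ) (v w : List ℕ) :
    dfaoRun trans s (v ++ w) = dfaoRun trans (dfaoRun trans s v) w := by
  simp [dfaoRun_eq_foldl]

theorem encode_le_encode_of_mem {α : Type*} [Encodable α] {x : α} {l : List α} (h : x ∈ l) :
    Encodable.encode x ≤ Encodable.encode l := by
  induction l with
  | nil => simp at h
  | cons y l ih =>
    rw [Encodable.encode_list_cons]
    rcases List.mem_cons.1 h with rfl | h
    · exact (Nat.left_le_pair _ _).trans (Nat.le_succ _)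
    · exact (ih h).trans ((Nat.right_le_pair _ _).trans (Nat.le_succ _))

theorem encode_getD_le {α : Type*} [Encodable α] (l : List α) (n : ℕ) (d : α)
    (hd : Encodable.encode d = 0) : Encodable.encode (l.getD n d) ≤ Encodable.encode l := by
  rcases lt_or_ge n l.length with h | h
  · rw [List.getD_eq_getElem _ _ h]
    exact encode_le_encode_of_mem (List.getElem_mem h)
  · rw [List.getD_eq_default _ _ h, hd]
    exact Nat.zero_le _

theorem dfaoRun_le (trans : List (List ℕ)) (s : ℕ) (w : List ℕ) :
    dfaoRun trans s w ≤ s + Encodable.encode trans := by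
  rcases List.eq_nil_or_concat w with rfl | ⟨v, d, rfl⟩
  · exact Nat.le_add_right _ _
  · rw [List.concat_eq_append, dfaoRun_append]
    refine le_trans ?_ (Nat.le_add_left _ _)
    exact (encode_getD_le _ _ 0 rfl).trans (encode_getD_le _ _ [] rfl)

/-- The sequence generated by the automaton when started in the state `s`. -/
def dfaoValue (k : ℕ) (trans : List (List ℕ)) (out : List ℕ) (s m : ℕ) : ℕ :=
  out.getD (dfaoRun trans s (lowDigits k m m)) 0

theorem dfaoGenerates.apply_pow_mul_add {k : ℕ} {trans : List (List ℕ)} {q0 : ℕ} {out : List ℕ}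
    {a : ℕ → ℕ} (h : dfaoGenerates k trans q0 out a) (hk : 2 ≤ k) {e x : ℕ} (hx : x < k ^ e)
    (m : ℕ) :
    a (k ^ e * m + x) = dfaoValue k trans out (dfaoRun trans q0 (lowDigits k e x)) m := by
  rw [dfaoValue, ← dfaoRun_append]
  apply h
  · intro d hd
    rcases List.mem_append.1 hd with hd | hd <;> exact lt_of_mem_lowDigits (by lia) hd
  · rw [Nat.ofDigits_append, length_lowDigits, ofDigits_lowDigits, ofDigits_lowDigits,
      Nat.mod_eq_of_lt hx, Nat.mod_eq_of_lt (Nat.lt_pow_self hk), add_comm]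

theorem dfaoGenerates.eq_dfaoValue {k : ℕ} {trans : List (List ℕ)} {q0 : ℕ} {out : List ℕ}
    {a : ℕ → ℕ} (h : dfaoGenerates k trans q0 out a) (hk : 2 ≤ k) :
    a = dfaoValue k trans out q0 := by
  funext m
  simpa [lowDigits, dfaoRun] using h.apply_pow_mul_add hk (e := 0) (x := 0) (by simp) m

/-- A binary relation on `ℕ` recognised, reading pairs of base-`k` digits starting from the least
significant ones, with states `σ e i t` in the finite set `F`. -/
structure IsRecognized {α : Type*} (k : ℕ) (W : ℕ → ℕ → Prop) (F : Finset α)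
    (σ : ℕ → ℕ → ℕ → α) : Prop where
  mem : ∀ e i t, i < k ^ e → t < k ^ e → σ e i t ∈ F
  congr : ∀ e₁ i₁ t₁ e₂ i₂ t₂, i₁ < k ^ e₁ → t₁ < k ^ e₁ → i₂ < k ^ e₂ → t₂ < k ^ e₂ →
    σ e₁ i₁ t₁ = σ e₂ i₂ t₂ → ∀ I T, W (k ^ e₁ * I + i₁) (k ^ e₁ * T + t₁) ↔
      W (k ^ e₂ * I + i₂) (k ^ e₂ * T + t₂)

namespace IsRecognized

variable {α : Type*} {k : ℕ} {W : ℕ → ℕ → Prop} {F : Finset α} {σ : ℕ → ℕ → ℕ → α}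

theorem exists_lt_congr (h : IsRecognized k W F σ) (hk : 2 ≤ k) {N : ℕ} (hN : F.card ≤ N)
    (n I T : ℕ) : ∃ e₁ e₂, n ≤ e₁ ∧ e₁ < e₂ ∧ e₂ ≤ n + N ∧ ∀ I' T',
      W (k ^ e₁ * I' + I % k ^ e₁) (k ^ e₁ * T' + T % k ^ e₁) ↔
        W (k ^ e₂ * I' + I % k ^ e₂) (k ^ e₂ * T' + T % k ^ e₂) := by
  have hpos : ∀ e, 0 < k ^ e := fun e => Nat.pow_pos (by lia)
  obtain ⟨x, hx, y, hy, hxy, heq⟩ := Finset.exists_ne_map_eq_of_card_lt_of_maps_to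
    (s := Finset.Icc n (n + N)) (t := F) (f := fun e => σ e (I % k ^ e) (T % k ^ e))
    (by rw [Nat.card_Icc]; lia)
    (fun e _ => h.mem e _ _ (Nat.mod_lt _ (hpos e)) (Nat.mod_lt _ (hpos e)))
  rw [Finset.mem_Icc] at hx hy
  have hc := h.congr x _ _ y _ _ (Nat.mod_lt I (hpos x)) (Nat.mod_lt T (hpos x))
    (Nat.mod_lt I (hpos y)) (Nat.mod_lt T (hpos y)) heq
  rcases lt_or_gt_of_ne hxy with hlt | hlt
  · exact ⟨x, y, hx.1, hlt, hy.2, hc⟩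
  · exact ⟨y, x, hy.1, hlt, hx.2, fun I' T' => (hc I' T').symm⟩

theorem div_pow_lt {k e₁ e₂ n : ℕ} (hk : 2 ≤ k) (he : e₁ < e₂) (hn : k ^ e₁ ≤ n) :
    n / k ^ e₂ < n / k ^ e₁ := by
  obtain ⟨d, rfl⟩ := Nat.exists_eq_add_of_lt he
  rw [add_assoc, pow_add, ← Nat.div_div_eq_div_mul]
  exact Nat.div_lt_self (Nat.div_pos hn (Nat.pow_pos (by lia)))
    (Nat.one_lt_pow (by lia) (by lia))

/-- Repeating a block of digits. -/
theorem exists_gt (h : IsRecognized k W F σ) (hk : 2 ≤ k) {N : ℕ} (hN : F.card ≤ N)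
    {I T : ℕ} (hI : k ^ N ≤ I) (hW : W I T) : ∃ I' > I, ∃ T', W I' T' := by
  obtain ⟨e₁, e₂, -, hlt, hle, hc⟩ := h.exists_lt_congr hk hN 0 I T
  refine ⟨k ^ e₂ * (I / k ^ e₁) + I % k ^ e₂, ?_, k ^ e₂ * (T / k ^ e₁) + T % k ^ e₂, ?_⟩
  · have h1 : I / k ^ e₂ < I / k ^ e₁ :=
      div_pow_lt hk hlt ((Nat.pow_le_pow_right (by lia) (by lia)).trans hI)
    have h2 := Nat.div_add_mod I (k ^ e₂)
    have h3 := Nat.mul_lt_mul_of_pos_left h1 (Nat.pow_pos (n := e₂) (show 0 < k by lia))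
    lia
  · rw [← hc, Nat.div_add_mod, Nat.div_add_mod]
    exact hW

/-- Deleting a block of digits. -/
theorem exists_add_lt (h : IsRecognized k W F σ) (hk : 2 ≤ k) {N : ℕ} (hN : F.card ≤ N)
    {I T : ℕ} (hI : k ^ N ≤ I) (hW : W I T)
    (hbig : k ^ (2 * N + 1) ≤ I ∨ k ^ (3 * N + 1) ≤ T) :
    ∃ I' T', k ^ N ≤ I' ∧ W I' T' ∧ I' + T' < I + T := by
  have hshrink : ∀ {e₁ e₂ n : ℕ}, e₁ < e₂ → k ^ e₂ ≤ n →
      k ^ e₁ * (n / k ^ e₂) + n % k ^ e₁ < n := by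
    intro e₁ e₂ n he hn
    have h1 : n / k ^ e₂ < n / k ^ e₁ :=
      div_pow_lt hk he ((Nat.pow_le_pow_right (by lia) he.le).trans hn)
    have h2 := Nat.div_add_mod n (k ^ e₁)
    have h3 := Nat.mul_lt_mul_of_pos_left h1 (Nat.pow_pos (n := e₁) (show 0 < k by lia))
    lia
  have hshrink' : ∀ {e₁ e₂ n : ℕ}, e₁ < e₂ →
      k ^ e₁ * (n / k ^ e₂) + n % k ^ e₁ ≤ n := by
    intro e₁ e₂ n he
    rcases lt_or_ge n (k ^ e₂) with hn | hn
    · rw [Nat.div_eq_of_lt hn]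
      simpa using Nat.mod_le _ _
    · exact (hshrink he hn).le
  rcases lt_or_ge I (k ^ (2 * N + 1)) with hI2 | hI2
  · have hT := hbig.resolve_left (by lia)
    obtain ⟨e₁, e₂, hn, hlt, hle, hc⟩ := h.exists_lt_congr hk hN (2 * N + 1) I T
    have hIe : ∀ e, 2 * N + 1 ≤ e → I < k ^ e := fun e he =>
      hI2.trans_le (Nat.pow_le_pow_right (by lia) he)
    refine ⟨I, k ^ e₁ * (T / k ^ e₂) + T % k ^ e₁, hI, ?_, ?_⟩
    · have := hc 0 (T / k ^ e₂)
      rw [Nat.div_add_mod, Nat.mod_eq_of_lt (hIe e₁ hn), Nat.mod_eq_of_lt (hIe e₂ (by lia)),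
        mul_zero, mul_zero, zero_add] at this
      exact this.2 hW
    · exact Nat.add_lt_add_left
        (hshrink hlt ((Nat.pow_le_pow_right (by lia) (by lia)).trans hT)) _
  · obtain ⟨e₁, e₂, hn, hlt, hle, hc⟩ := h.exists_lt_congr hk hN N I T
    have hIe : k ^ e₂ ≤ I := (Nat.pow_le_pow_right (by lia) (by lia)).trans hI2
    refine ⟨k ^ e₁ * (I / k ^ e₂) + I % k ^ e₁, k ^ e₁ * (T / k ^ e₂) + T % k ^ e₁, ?_, ?_, ?_⟩
    · have h1 : 0 < I / k ^ e₂ := Nat.div_pos hIe (Nat.pow_pos (by lia))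
      calc k ^ N ≤ k ^ e₁ := Nat.pow_le_pow_right (by lia) hn
        _ ≤ k ^ e₁ * (I / k ^ e₂) := Nat.le_mul_of_pos_right _ h1
        _ ≤ _ := Nat.le_add_right _ _
    · rw [hc, Nat.div_add_mod, Nat.div_add_mod]
      exact hW
    · exact Nat.add_lt_add_of_lt_of_le (hshrink hlt hIe) (hshrink' hlt)

theorem exists_bounded (h : IsRecognized k W F σ) (hk : 2 ≤ k) {N : ℕ} (hN : F.card ≤ N)
    (n : ℕ) : ∀ I T, I + T = n → k ^ N ≤ I → W I T →
      ∃ I < k ^ (2 * N + 1), ∃ T < k ^ (3 * N + 1), k ^ N ≤ I ∧ W I T := by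
  induction n using Nat.strong_induction_on with
  | _ n ih =>
    intro I T hn hI hW
    by_cases hbig : k ^ (2 * N + 1) ≤ I ∨ k ^ (3 * N + 1) ≤ T
    · obtain ⟨I', T', hI', hW', hlt⟩ := h.exists_add_lt hk hN hI hW hbig
      exact ih _ (hn ▸ hlt) I' T' rfl hI' hW'
    · rw [not_or, not_le, not_le] at hbig
      exact ⟨I, hbig.1, T, hbig.2, hI, hW⟩

theorem infinite_iff (h : IsRecognized k W F σ) (hk : 2 ≤ k) {N : ℕ} (hN : F.card ≤ N) :
    {I | ∃ T, W I T}.Infinite ↔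
      ∃ I < k ^ (2 * N + 1), ∃ T < k ^ (3 * N + 1), k ^ N ≤ I ∧ W I T := by
  constructor
  · intro hinf
    obtain ⟨I, ⟨T, hW⟩, hI⟩ := hinf.exists_gt (k ^ N)
    exact h.exists_bounded hk hN _ I T rfl hI.le hW
  · rintro ⟨I, -, T, -, hI, hW⟩ hfin
    obtain ⟨M, ⟨⟨T', hM⟩, hIM⟩, hmax⟩ :=
      (hfin.inter_of_left {J | I ≤ J}).exists_maximal ⟨I, ⟨T, hW⟩, le_refl I⟩
    have hIM' : I ≤ M := hIM
    obtain ⟨J, hJ, T'', hW''⟩ := h.exists_gt hk hN (hI.trans hIM') hM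
    have : J ≤ M := hmax ⟨⟨T'', hW''⟩, hIM'.trans hJ.le⟩ hJ.le
    lia

end IsRecognized

/-- `a (I + j) = a (I + j + T)` for all offsets `j` with `q * j < c * T + ε`, where the period `T`
is nonzero. -/
def HasPeriodAt (a : ℕ → ℕ) (c q ε I T : ℕ) : Prop :=
  T ≠ 0 ∧ ∀ j, q * j < c * T + ε → a (I + j) = a (I + j + T)

theorem add_lt_add_ceilDiv_iff {K A B D : ℕ} (hK : 0 < K) :
    K * A < K * B + D ↔ A < B + (D + K - 1) / K := by
  have h1 := Nat.div_add_mod (D + K - 1) K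
  have h2 := Nat.mod_lt (D + K - 1) hK
  generalize (D + K - 1) / K = g at h1 ⊢
  constructor
  · intro h
    by_contra! hcon
    have := Nat.mul_le_mul_left K hcon
    rw [mul_add] at this
    lia
  · intro h
    have := Nat.mul_le_mul_left K (Nat.succ_le_of_lt h)
    rw [mul_add, Nat.mul_succ] at this
    lia

/-- The constraint on the high digits imposed by the low digits `r` of the offset `j`. -/
def offsetConstraint (st : ℕ → ℕ → ℕ) (k c q ε e i t r : ℕ) : ℕ × ℕ × ℕ × ℕ × ℕ :=
  ((i + r) / k ^ e, (i + r + t) / k ^ e,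
    (c * t + ε + q * (k ^ e - r) + k ^ e - 1) / k ^ e,
    st e ((i + r) % k ^ e), st e ((i + r + t) % k ^ e))

/-- The state of the recogniser of `HasPeriodAt` after reading `e` digits. -/
def periodState (st : ℕ → ℕ → ℕ) (k c q ε e i t : ℕ) :
    Finset (ℕ × ℕ × ℕ × ℕ × ℕ) × Bool :=
  ((Finset.range (k ^ e)).image (offsetConstraint st k c q ε e i t), decide (t = 0))

/-- The relation on the high digits attached to a state of the recogniser. -/
def periodResidual (b : ℕ → ℕ → ℕ) (c q : ℕ) (U : Finset (ℕ × ℕ × ℕ × ℕ × ℕ) × Bool)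
    (I T : ℕ) : Prop :=
  ¬(T = 0 ∧ U.2 = true) ∧ ∀ u ∈ U.1, ∀ j, q * j + q < c * T + u.2.2.1 →
    b u.2.2.2.1 (I + j + u.1) = b u.2.2.2.2 (I + j + T + u.2.1)

theorem hasPeriodAt_iff_periodResidual {a : ℕ → ℕ} {b st : ℕ → ℕ → ℕ} {k : ℕ} (hk : 0 < k)
    (hab : ∀ e x m, x < k ^ e → a (k ^ e * m + x) = b (st e x) m)
    (c q ε e i t I T : ℕ) :
    HasPeriodAt a c q ε (k ^ e * I + i) (k ^ e * T + t) ↔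
      periodResidual b c q (periodState st k c q ε e i t) I T := by
  have hK : 0 < k ^ e := Nat.pow_pos hk
  have hval : ∀ m x, a (k ^ e * m + x) = b (st e (x % k ^ e)) (m + x / k ^ e) := by
    intro m x
    rw [← hab e _ _ (Nat.mod_lt _ hK), mul_add, add_assoc, Nat.div_add_mod]
  have hcond : ∀ j r, r < k ^ e → (q * (k ^ e * j + r) < c * (k ^ e * T + t) + ε ↔
      q * j + q < c * T + (c * t + ε + q * (k ^ e - r) + k ^ e - 1) / k ^ e) := by
    intro j r hr
    rw [← add_lt_add_ceilDiv_iff hK]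
    obtain ⟨s, hs⟩ := Nat.exists_eq_add_of_lt hr
    rw [show k ^ e - r = s + 1 by lia, hs]
    constructor <;> intro h <;> nlinarith
  unfold HasPeriodAt periodResidual periodState
  refine and_congr ?_ ?_
  · simp [hk.ne']
  · simp only [Finset.mem_image, Finset.mem_range, forall_exists_index, and_imp,
      forall_apply_eq_imp_iff₂]
    have heq : ∀ j r, a (k ^ e * I + i + (k ^ e * j + r)) =
        a (k ^ e * I + i + (k ^ e * j + r) + (k ^ e * T + t)) ↔
        b (st e ((i + r) % k ^ e)) (I + j + (i + r) / k ^ e) =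
          b (st e ((i + r + t) % k ^ e)) (I + j + T + (i + r + t) / k ^ e) := by
      intro j r
      rw [← hval, ← hval]
      ring_nf
    constructor
    · intro h r hr j hj
      exact (heq j r).1 (h _ ((hcond j r hr).2 hj))
    · intro h j hj
      have hr := Nat.mod_lt j hK
      have hj' := Nat.div_add_mod j (k ^ e)
      have := (heq (j / k ^ e) (j % k ^ e)).2 (h _ hr _ ((hcond _ _ hr).1 (by rwa [hj'])))
      rwa [hj'] at this

/-- The set of all possible states of the recogniser of `HasPeriodAt`. -/
def periodStates (B : ℕ) : Finset (Finset (ℕ × ℕ × ℕ × ℕ × ℕ) × Bool) :=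
  (Finset.range B ×ˢ Finset.range B ×ˢ Finset.range B ×ˢ Finset.range B ×ˢ
    Finset.range B).powerset ×ˢ Finset.univ

theorem card_periodStates (B : ℕ) :
    (periodStates B).card = 2 ^ (B * (B * (B * (B * B)))) * 2 := by
  simp [periodStates]

theorem isRecognized_hasPeriodAt {a : ℕ → ℕ} {b st : ℕ → ℕ → ℕ} {k : ℕ} (hk : 0 < k)
    (hab : ∀ e x m, x < k ^ e → a (k ^ e * m + x) = b (st e x) m)
    {S : ℕ} (hst : ∀ e x, st e x ≤ S) {c q ε : ℕ} (hε : ε ≤ 1) :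
    IsRecognized k (HasPeriodAt a c q ε) (periodStates (S + c + q + 3))
      (periodState st k c q ε) where
  mem e i t hi ht := by
    have hK : 0 < k ^ e := Nat.pow_pos hk
    simp only [periodStates, periodState, Finset.mem_product, Finset.mem_univ, and_true,
      Finset.mem_powerset]
    intro u hu
    obtain ⟨r, hr, rfl⟩ := Finset.mem_image.1 hu
    rw [Finset.mem_range] at hr
    simp only [offsetConstraint, Finset.mem_product, Finset.mem_range]
    refine ⟨?_, ?_, ?_, ?_, ?_⟩
    · exact (Nat.div_lt_of_lt_mul (m := i + r) (k := 2) (by lia)).trans (by lia)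
    · exact (Nat.div_lt_of_lt_mul (k := 3) (by lia)).trans_le (by lia)
    · apply Nat.div_lt_of_lt_mul
      have h1 : c * t ≤ c * k ^ e := Nat.mul_le_mul_left _ ht.le
      have h2 : q * (k ^ e - r) ≤ q * k ^ e := Nat.mul_le_mul_left _ (Nat.sub_le _ _)
      have h3 : k ^ e * (S + c + q + 3) = k ^ e * S + c * k ^ e + q * k ^ e + 3 * k ^ e := by ring
      lia
    · exact (hst _ _).trans_lt (by lia)
    · exact (hst _ _).trans_lt (by lia)
  congr e₁ i₁ t₁ e₂ i₂ t₂ _ _ _ _ h I T := by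
    rw [hasPeriodAt_iff_periodResidual hk hab, hasPeriodAt_iff_periodResidual hk hab, h]

theorem length_factorAt (a : ℕ → ℕ) (i L : ℕ) : (factorAt a i L).length = L := by
  simp [factorAt]

theorem getD_factorAt (a : ℕ → ℕ) (i : ℕ) {j L : ℕ} (h : j < L) :
    (factorAt a i L).getD j 0 = a (i + j) := by
  simp [factorAt, h]

theorem exists_isRPower_factorAt_iff (a : ℕ → ℕ) {p q : ℕ} (hq : 0 < q) (hpq : q < p) (I : ℕ) :
    (∃ L, IsRPower p q (factorAt a I L)) ↔ ∃ T, HasPeriodAt a (p - q) q 0 I T := by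
  obtain ⟨c, rfl⟩ := Nat.exists_eq_add_of_lt hpq
  rw [show q + c + 1 - q = c + 1 by lia]
  constructor
  · rintro ⟨L, T, hT, -, hper, h1, h2⟩
    rw [length_factorAt] at *
    refine ⟨T, by lia, fun j hj => ?_⟩
    have hjL : j + T < L := by
      by_contra! hcon
      have := Nat.mul_le_mul_left q hcon
      nlinarith
    have := hper j hjL
    rwa [getD_factorAt _ _ (by lia), getD_factorAt _ _ hjL, ← add_assoc] at this
  · rintro ⟨T, hT, hper⟩
    set L := ((q + c + 1) * T + q - 1) / q with hL
    have h1 := Nat.div_add_mod ((q + c + 1) * T + q - 1) q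
    have h2 := Nat.mod_lt ((q + c + 1) * T + q - 1) hq
    rw [← hL] at h1
    have hpos : 0 < (q + c + 1) * T := Nat.mul_pos (by lia) (by lia)
    have h3 : (q + c + 1) * T ≤ q * L := by lia
    have h4 : q * (L - 1) < (q + c + 1) * T := by
      rw [Nat.mul_sub, mul_one]
      lia
    refine ⟨L, T, by lia, ?_, ?_, ?_, ?_⟩ <;> rw [length_factorAt]
    · by_contra! hcon
      have := Nat.mul_lt_mul_of_pos_left hcon hq
      nlinarith
    · intro j hj
      rw [getD_factorAt _ _ (by lia), getD_factorAt _ _ hj, ← add_assoc]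
      apply hper
      have := Nat.mul_le_mul_left q (show j + T ≤ L - 1 by lia)
      nlinarith
    · exact h3
    · exact h4

theorem exists_isRPlusPower_factorAt_iff (a : ℕ → ℕ) {p q : ℕ} (hq : 0 < q) (hpq : q < p)
    (I : ℕ) :
    (∃ L, IsRPlusPower p q (factorAt a I L)) ↔ ∃ T, HasPeriodAt a (p - q) q 1 I T := by
  obtain ⟨c, rfl⟩ := Nat.exists_eq_add_of_lt hpq
  rw [show q + c + 1 - q = c + 1 by lia]
  constructor
  · rintro ⟨L, T, hT, -, hper, h1, h2⟩
    rw [length_factorAt] at *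
    refine ⟨T, by lia, fun j hj => ?_⟩
    have hjL : j + T < L := by
      by_contra! hcon
      have := Nat.mul_le_mul_left q hcon
      nlinarith
    have := hper j hjL
    rwa [getD_factorAt _ _ (by lia), getD_factorAt _ _ hjL, ← add_assoc] at this
  · rintro ⟨T, hT, hper⟩
    set M := (q + c + 1) * T / q with hM
    have h1 := Nat.div_add_mod ((q + c + 1) * T) q
    have h2 := Nat.mod_lt ((q + c + 1) * T) hq
    rw [← hM] at h1
    have hTM : T ≤ M := by
      by_contra! hcon
      have := Nat.mul_le_mul_left q (Nat.succ_le_of_lt hcon)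
      nlinarith
    refine ⟨M + 1, T, by lia, ?_, ?_, ?_, ?_⟩ <;> rw [length_factorAt]
    · lia
    · intro j hj
      rw [getD_factorAt _ _ (by lia), getD_factorAt _ _ hj, ← add_assoc]
      apply hper
      have h3 := Nat.mul_le_mul_left q (show j + T ≤ M by lia)
      have h4 : q * j + q * T ≤ (q + c + 1) * T := by
        rw [← mul_add]
        lia
      nlinarith
    · rw [mul_add, mul_one]
      lia
    · rw [Nat.add_sub_cancel]
      lia

/-- A bound for the number of states of the recogniser of `HasPeriodAt`. -/
def stateBound (trans : List (List ℕ)) (q0 p : ℕ) : ℕ :=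
  (fun B => 2 ^ (B * (B * (B * (B * B)))) * 2) (q0 + Encodable.encode trans + p + 3)

/-- The bounded search deciding whether `HasPeriodAt` holds for infinitely many positions. -/
def PeriodSearch (ε k : ℕ) (trans : List (List ℕ)) (q0 : ℕ) (out : List ℕ) (p q : ℕ) : Prop :=
  ∃ I < k ^ (2 * stateBound trans q0 p + 1), ∃ T < k ^ (3 * stateBound trans q0 p + 1),
    k ^ stateBound trans q0 p ≤ I ∧ T ≠ 0 ∧ ∀ j < (p - q) * T + ε, q * j < (p - q) * T + ε →
      dfaoValue k trans out q0 (I + j) = dfaoValue k trans out q0 (I + j + T)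

theorem infinite_hasPeriodAt_iff {k : ℕ} {trans : List (List ℕ)} {q0 : ℕ} {out : List ℕ}
    {a : ℕ → ℕ} {p q ε : ℕ} (hk : 2 ≤ k) (h : dfaoGenerates k trans q0 out a) (hq : 0 < q)
    (hpq : q < p) (hε : ε ≤ 1) :
    {I | ∃ T, HasPeriodAt a (p - q) q ε I T}.Infinite ↔ PeriodSearch ε k trans q0 out p q := by
  have hrec := isRecognized_hasPeriodAt (c := p - q) (q := q) (show 0 < k by lia)
    (fun e x m hx => h.apply_pow_mul_add hk hx m)
    (fun e x => dfaoRun_le trans q0 (lowDigits k e x)) hε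
  have hcard : (periodStates (q0 + Encodable.encode trans + (p - q) + q + 3)).card ≤
      stateBound trans q0 p := by
    rw [card_periodStates, add_assoc _ (p - q) q, Nat.sub_add_cancel hpq.le, stateBound]
  rw [hrec.infinite_iff hk hcard, PeriodSearch, ← h.eq_dfaoValue hk]
  refine exists_congr fun I => and_congr_right fun _ => exists_congr fun T =>
    and_congr_right fun _ => and_congr_right fun _ => and_congr_right fun _ => ?_
  exact forall_congr' fun j =>
    ⟨fun hj _ => hj, fun hj hlt => hj ((Nat.le_mul_of_pos_left j hq).trans_lt hlt) hlt⟩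

section Primrec

variable {α : Type*} [Primcodable α]

theorem primrec₂_pow : Primrec₂ ((· ^ ·) : ℕ → ℕ → ℕ) := by
  refine (Primrec.nat_rec (f := fun _ : ℕ => 1) (g := fun m (y : ℕ × ℕ) => y.2 * m)
    (Primrec.const 1)
    (Primrec.nat_mul.comp (Primrec.snd.comp Primrec.snd) Primrec.fst)).of_eq fun m n => ?_
  induction n with
  | zero => rfl
  | succ n ih => simp_all [pow_succ]

theorem PrimrecPred.exists_lt_of_primrec {P : α × ℕ → Prop} (hP : PrimrecPred P)
    {n : α → ℕ} (hn : Primrec n) : PrimrecPred fun a => ∃ x < n a, P (a, x) :=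
  ((PrimrecRel.exists_mem_list (R := fun (x : ℕ) (a : α) => P (a, x))
    (hP.comp (Primrec.snd.pair Primrec.fst))).comp (Primrec.list_range.comp hn) Primrec.id).of_eq
      (by simp)

theorem PrimrecPred.forall_lt_of_primrec {P : α × ℕ → Prop} (hP : PrimrecPred P)
    {n : α → ℕ} (hn : Primrec n) : PrimrecPred fun a => ∀ x < n a, P (a, x) :=
  ((PrimrecRel.forall_mem_list (R := fun (x : ℕ) (a : α) => P (a, x))
    (hP.comp (Primrec.snd.pair Primrec.fst))).comp (Primrec.list_range.comp hn) Primrec.id).of_eq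
      (by simp)

theorem primrec_dfaoValue {k s m : α → ℕ} {trans : α → List (List ℕ)} {out : α → List ℕ}
    (hk : Primrec k) (ht : Primrec trans) (ho : Primrec out) (hs : Primrec s) (hm : Primrec m) :
    Primrec fun x => dfaoValue (k x) (trans x) (out x) (s x) (m x) := by
  simp only [dfaoValue, dfaoRun_eq_foldl, lowDigits]
  refine (Primrec.list_getD 0).comp ho (Primrec.list_foldl
    (h := fun x (y : ℕ × ℕ) => ((trans x).getD y.1 []).getD y.2 0)
    (Primrec.list_map (Primrec.list_range.comp hm) ?_) hs ?_)
  · exact Primrec.nat_mod.comp (Primrec.nat_div.comp (hm.comp Primrec.fst)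
      (primrec₂_pow.comp (hk.comp Primrec.fst) Primrec.snd)) (hk.comp Primrec.fst)
  · exact (Primrec.list_getD 0).comp ((Primrec.list_getD []).comp (ht.comp Primrec.fst)
      (Primrec.fst.comp Primrec.snd)) (Primrec.snd.comp Primrec.snd)

theorem primrec_stateBound {q0 p : α → ℕ} {trans : α → List (List ℕ)} (ht : Primrec trans)
    (hq0 : Primrec q0) (hp : Primrec p) : Primrec fun x => stateBound (trans x) (q0 x) (p x) := by
  have hB : Primrec fun B : ℕ => 2 ^ (B * (B * (B * (B * B)))) * 2 :=
    Primrec.nat_mul.comp (primrec₂_pow.comp (Primrec.const 2)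
      (Primrec.nat_mul.comp Primrec.id (Primrec.nat_mul.comp Primrec.id
        (Primrec.nat_mul.comp Primrec.id (Primrec.nat_mul.comp Primrec.id Primrec.id)))))
      (Primrec.const 2)
  exact hB.comp (Primrec.nat_add.comp (Primrec.nat_add.comp (Primrec.nat_add.comp hq0
    (Primrec.encode.comp ht)) hp) (Primrec.const 3))

theorem primrecPred_periodSearch (ε : ℕ) {k q0 p q : α → ℕ} {trans : α → List (List ℕ)}
    {out : α → List ℕ} (hk : Primrec k) (ht : Primrec trans) (hq0 : Primrec q0)
    (ho : Primrec out) (hp : Primrec p) (hq : Primrec q) :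
    PrimrecPred fun x => PeriodSearch ε (k x) (trans x) (q0 x) (out x) (p x) (q x) := by
  have hN := primrec_stateBound ht hq0 hp
  have hpow : ∀ c : ℕ, Primrec fun x => k x ^ (c * stateBound (trans x) (q0 x) (p x) + 1) :=
    fun c => primrec₂_pow.comp hk
      (Primrec.nat_add.comp (Primrec.nat_mul.comp (Primrec.const c) hN) (Primrec.const 1))
  have hx1 : Primrec fun y : α × ℕ => y.1 := Primrec.fst
  have hx2 : Primrec fun z : (α × ℕ) × ℕ => z.1.1 := Primrec.fst.comp Primrec.fst
  have hx3 : Primrec fun w : ((α × ℕ) × ℕ) × ℕ => w.1.1.1 := hx2.comp Primrec.fst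
  have hI3 : Primrec fun w : ((α × ℕ) × ℕ) × ℕ => w.1.1.2 :=
    Primrec.snd.comp (Primrec.fst.comp Primrec.fst)
  have hT3 : Primrec fun w : ((α × ℕ) × ℕ) × ℕ => w.1.2 := Primrec.snd.comp Primrec.fst
  have hIj := Primrec.nat_add.comp hI3 Primrec.snd
  have hlen : Primrec fun z : (α × ℕ) × ℕ => (p z.1.1 - q z.1.1) * z.2 + ε :=
    Primrec.nat_add.comp (Primrec.nat_mul.comp
      (Primrec.nat_sub.comp (hp.comp hx2) (hq.comp hx2)) Primrec.snd) (Primrec.const ε)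
  have hval : ∀ {m : ((α × ℕ) × ℕ) × ℕ → ℕ}, Primrec m → Primrec fun w =>
      dfaoValue (k w.1.1.1) (trans w.1.1.1) (out w.1.1.1) (q0 w.1.1.1) (m w) := fun hm =>
    primrec_dfaoValue (hk.comp hx3) (ht.comp hx3) (ho.comp hx3) (hq0.comp hx3) hm
  have hperiod : PrimrecRel fun (z : (α × ℕ) × ℕ) (j : ℕ) =>
      q z.1.1 * j < (p z.1.1 - q z.1.1) * z.2 + ε →
        dfaoValue (k z.1.1) (trans z.1.1) (out z.1.1) (q0 z.1.1) (z.1.2 + j) =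
          dfaoValue (k z.1.1) (trans z.1.1) (out z.1.1) (q0 z.1.1) (z.1.2 + j + z.2) := by
    exact PrimrecPred.of_eq (.or (.not (Primrec.nat_lt.comp (Primrec.nat_mul.comp
      (hq.comp hx3) Primrec.snd) (hlen.comp Primrec.fst))) (Primrec.eq.comp (hval hIj)
      (hval (Primrec.nat_add.comp hIj hT3)))) fun _ => imp_iff_not_or.symm
  have hpair : PrimrecRel fun (y : α × ℕ) (T : ℕ) =>
      k y.1 ^ stateBound (trans y.1) (q0 y.1) (p y.1) ≤ y.2 ∧ T ≠ 0 ∧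
        ∀ j < (p y.1 - q y.1) * T + ε, q y.1 * j < (p y.1 - q y.1) * T + ε →
          dfaoValue (k y.1) (trans y.1) (out y.1) (q0 y.1) (y.2 + j) =
            dfaoValue (k y.1) (trans y.1) (out y.1) (q0 y.1) (y.2 + j + T) :=
    .and (Primrec.nat_le.comp (primrec₂_pow.comp (hk.comp hx2) (hN.comp hx2))
      (Primrec.snd.comp Primrec.fst)) (.and (Primrec.eq.comp Primrec.snd (Primrec.const 0)).not
        (PrimrecPred.forall_lt_of_primrec hperiod hlen))
  have hsearch := PrimrecPred.exists_lt_of_primrec hpair ((hpow 3).comp hx1)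
  exact hsearch.exists_lt_of_primrec (hpow 2)

theorem PrimrecPred.exists_computable {P : α → Prop} (h : PrimrecPred P) :
    ∃ f : α → Bool, Computable f ∧ ∀ x, f x = true ↔ P x := by
  obtain ⟨_, h⟩ := h
  exact ⟨fun x => decide (P x), h.to_comp, fun x => decide_eq_true_iff⟩

end Primrec

/-- It is decidable, given `k ≥ 2`, a DFAO generating a `k`-automatic sequence
`a`, and a rational `r = p/q > 1`, whether there are infinitely many positions
`I` at which an `r`-power factor of `a` begins; and likewise for `r⁺`-powers. -/
theorem infinitelyManyRPowerOccurrences_decidable :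
    ∃ f g : ℕ × List (List ℕ) × ℕ × List ℕ × ℕ × ℕ → Bool,
      Computable f ∧ Computable g ∧
      ∀ (k : ℕ) (trans : List (List ℕ)) (q0 : ℕ) (out : List ℕ) (a : ℕ → ℕ)
        (p q : ℕ),
        2 ≤ k → dfaoGenerates k trans q0 out a → 1 ≤ q → q < p →
        ((f (k, trans, q0, out, p, q) = true ↔
            {I : ℕ | ∃ L : ℕ, IsRPower p q (factorAt a I L)}.Infinite) ∧
         (g (k, trans, q0, out, p, q) = true ↔
            {I : ℕ | ∃ L : ℕ, IsRPlusPower p q (factorAt a I L)}.Infinite)) := by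
  have hsearch := fun ε => (primrecPred_periodSearch
    (α := ℕ × List (List ℕ) × ℕ × List ℕ × ℕ × ℕ) ε Primrec.fst
    (Primrec.fst.comp Primrec.snd) (Primrec.fst.comp (Primrec.snd.comp Primrec.snd))
    (Primrec.fst.comp (Primrec.snd.comp (Primrec.snd.comp Primrec.snd)))
    (Primrec.fst.comp (Primrec.snd.comp (Primrec.snd.comp (Primrec.snd.comp Primrec.snd))))
    (Primrec.snd.comp (Primrec.snd.comp
      (Primrec.snd.comp (Primrec.snd.comp Primrec.snd))))).exists_computable
  obtain ⟨f, hf, hfs⟩ := hsearch 0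
  obtain ⟨g, hg, hgs⟩ := hsearch 1
  refine ⟨f, g, hf, hg, fun k trans q0 out a p q hk h hq hpq => ⟨?_, ?_⟩⟩
  · simp only [hfs, exists_isRPower_factorAt_iff a hq hpq]
    exact (infinite_hasPeriodAt_iff hk h hq hpq zero_le_one).symm
  · simp only [hgs, exists_isRPlusPower_factorAt_iff a hq hpq]
    exact (infinite_hasPeriodAt_iff hk h hq hpq le_rfl).symm
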